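/- Let M_1,…,M_l be jointly distributed finitely supported random variables, let ψ be a positive integer, let ρ ∈ [1,∞), and set β = 14ρ + 2^{−ρ}·ψ. There exists a random variable Q that is a deterministic function of (M_1,…,M_l) and takes at most (ψ+1)^l values, such that for every finitely supported random variable U, jointly distributed with (M_1,…,M_l), from which Q is almost surely recoverable as a deterministic function, and for every j ∈ [1:l], there exist sets 𝒰_{j,stable} and 𝒰_{j,sat} of values of U such that: (i) P(U ∈ 𝒰_{j,stable} ∪ 𝒰_{j,sat}) ≥ 1 − 2^{−ρ}; (ii) for every u ∈ 𝒰_{j,stable}, Pr(|h(M_j|U) − H(M_j|U=u)| > β + 3·log₂|𝒰| | U=u) < 2^{−ρ}; (iii) for every u ∈ 𝒰_{j,sat}, Pr(h(M_j|U) < ψ − β − 3·log₂|𝒰| | U=u) < 2^{−ρ}. Moreover, if M_j is uniformly distributed on its finite range 𝓜_j, then there is a set 𝒰'_j of values of U with P(U ∈ 𝒰'_j) ≥ 1 − 2^{−ρ} such that for every u ∈ 𝒰'_j: Pr(|h(M_j|U) − log₂|𝓜_j|| > β + 3·log₂|𝒰| | U=u) < 2^{−ρ}. -/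

import Mathlib

open scoped Classical BigOperators

noncomputable section

namespace Paper

variable {Ω : Type*}

/-- Probability of an event under a discrete probability distribution. -/
def pr (μ : PMF Ω) (E : Set Ω) : ℝ := (μ.toOuterMeasure E).toReal

/-- Conditional probability `Pr(E | F)`. -/
def cpr (μ : PMF Ω) (E F : Set Ω) : ℝ := pr μ (E ∩ F) / pr μ F

/-- Entropy spectrum frequency `h_X(x) = -log₂ Pr(X = x)`. -/
def hs {α : Type*} (μ : PMF Ω) (X : Ω → α) (x : α) : ℝ :=
  - Real.logb 2 (pr μ {ω | X ω = x})

/-- Conditional entropy spectrum frequency `h_{X|Y}(x|y) = -log₂ Pr(X = x | Y = y)`. -/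
def hcs {α β : Type*} (μ : PMF Ω) (X : Ω → α) (Y : Ω → β) (x : α) (y : β) : ℝ :=
  - Real.logb 2 (cpr μ {ω | X ω = x} {ω | Y ω = y})

/-- Conditional Shannon entropy (bits) `H(X|Y)`. -/
def Hc {α β : Type*} [Fintype α] [Fintype β] (μ : PMF Ω) (X : Ω → α) (Y : Ω → β) : ℝ :=
  - ∑ x : α, ∑ y : β, pr μ ({ω | X ω = x} ∩ {ω | Y ω = y}) *
      Real.logb 2 (cpr μ {ω | X ω = x} {ω | Y ω = y})

/-- Shannon entropy (bits) of `X` conditioned on the event `E`. -/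
def HEvt {α : Type*} [Fintype α] (μ : PMF Ω) (X : Ω → α) (E : Set Ω) : ℝ :=
  - ∑ x : α, cpr μ {ω | X ω = x} E * Real.logb 2 (cpr μ {ω | X ω = x} E)

/-- Conditional Shannon entropy (bits) `H(X|Y)` computed given the event `E`. -/
def HcEvt {α β : Type*} [Fintype α] [Fintype β] (μ : PMF Ω) (X : Ω → α) (Y : Ω → β)
    (E : Set Ω) : ℝ :=
  - ∑ x : α, ∑ y : β, cpr μ ({ω | X ω = x} ∩ {ω | Y ω = y}) E *
      Real.logb 2 (cpr μ {ω | X ω = x} ({ω | Y ω = y} ∩ E))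

/-- `A ⊸ B ⊸ C` : `A` and `C` are conditionally independent given `B`. -/
def Markov {α β γ : Type*} (μ : PMF Ω) (A : Ω → α) (B : Ω → β) (C : Ω → γ) : Prop :=
  ∀ a b c, pr μ {ω | A ω = a ∧ B ω = b ∧ C ω = c} * pr μ {ω | B ω = b} =
    pr μ {ω | A ω = a ∧ B ω = b} * pr μ {ω | B ω = b ∧ C ω = c}

/-- A discrete memoryless channel from `𝒳` to `𝒴`. -/
structure Channel (𝒳 𝒴 : Type*) [Fintype 𝒴] where
  w : 𝒳 → 𝒴 → ℝ
  nonneg : ∀ x y, 0 ≤ w x y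
  sum_one : ∀ x, ∑ y, w x y = 1

/-- The `n`-fold product channel `W^n(𝐲|𝐱)`. -/
def Channel.pn {𝒳 𝒴 : Type*} [Fintype 𝒴] (W : Channel 𝒳 𝒴) (n : ℕ)
    (x : Fin n → 𝒳) (y : Fin n → 𝒴) : ℝ := ∏ i, W.w (x i) (y i)

/-- `Y` is an output of `X` through `W^n`. -/
def IsOutput {𝒳 𝒴 : Type*} [Fintype 𝒴] {n : ℕ} (μ : PMF Ω)
    (X : Ω → Fin n → 𝒳) (Y : Ω → Fin n → 𝒴) (W : Channel 𝒳 𝒴) : Prop :=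
  ∀ x y, 0 < pr μ {ω | X ω = x} → cpr μ {ω | Y ω = y} {ω | X ω = x} = W.pn n x y

/-- `W^n(B|𝐱)`. -/
def imgMass {𝒳 𝒴 : Type*} [Fintype 𝒴] (W : Channel 𝒳 𝒴) (n : ℕ)
    (x : Fin n → 𝒳) (B : Finset (Fin n → 𝒴)) : ℝ := ∑ y ∈ B, W.pn n x y

/-- `B` is an `η`-image of `A` by `W`. -/
def IsImage {𝒳 𝒴 : Type*} [Fintype 𝒴] (W : Channel 𝒳 𝒴) (n : ℕ)
    (A : Set (Fin n → 𝒳)) (η : ℝ) (B : Finset (Fin n → 𝒴)) : Prop :=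
  ∀ x ∈ A, η ≤ imgMass W n x B

/-- Minimum cardinality of an `η`-image of `A` by `W`. -/
def gimg {𝒳 𝒴 : Type*} [Fintype 𝒴] (W : Channel 𝒳 𝒴) (n : ℕ)
    (A : Set (Fin n → 𝒳)) (η : ℝ) : ℕ :=
  sInf {k | ∃ B : Finset (Fin n → 𝒴), IsImage W n A η B ∧ B.card = k}

/-- `B` is an `η`-quasi-image of the pmf `P` by `W`. -/
def IsQImage {𝒳 𝒴 : Type*} [Fintype 𝒳] [Fintype 𝒴] (W : Channel 𝒳 𝒴) (n : ℕ)
    (P : (Fin n → 𝒳) → ℝ) (η : ℝ) (B : Finset (Fin n → 𝒴)) : Prop :=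
  η ≤ ∑ x, imgMass W n x B * P x

/-- Minimum cardinality of an `η`-quasi-image of `P` by `W`. -/
def gqimg {𝒳 𝒴 : Type*} [Fintype 𝒳] [Fintype 𝒴] (W : Channel 𝒳 𝒴) (n : ℕ)
    (P : (Fin n → 𝒳) → ℝ) (η : ℝ) : ℕ :=
  sInf {k | ∃ B : Finset (Fin n → 𝒴), IsQImage W n P η B ∧ B.card = k}

/-- The number of values in the support of `U`. -/
def suppCard {α : Type*} [Fintype α] (μ : PMF Ω) (U : Ω → α) : ℕ :=
  (Finset.univ.filter (fun u => 0 < pr μ {ω | U ω = u})).card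

/-- Mutual information (bits). -/
def MI {α β : Type*} [Fintype α] [Fintype β] (μ : PMF Ω) (A : Ω → α) (B : Ω → β) : ℝ :=
  ∑ a : α, ∑ b : β, pr μ {ω | A ω = a ∧ B ω = b} *
    Real.logb 2 (pr μ {ω | A ω = a ∧ B ω = b} / (pr μ {ω | A ω = a} * pr μ {ω | B ω = b}))

/-- Conditional mutual information (bits). -/
def CMI {α β γ : Type*} [Fintype α] [Fintype β] [Fintype γ] (μ : PMF Ω)
    (A : Ω → α) (B : Ω → β) (C : Ω → γ) : ℝ :=
  ∑ c : γ, pr μ {ω | C ω = c} * ∑ a : α, ∑ b : β,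
    cpr μ {ω | A ω = a ∧ B ω = b} {ω | C ω = c} *
      Real.logb 2 (cpr μ {ω | A ω = a ∧ B ω = b} {ω | C ω = c} /
        (cpr μ {ω | A ω = a} {ω | C ω = c} * cpr μ {ω | B ω = b} {ω | C ω = c}))

/-- `D_{wh}(w‖w'|p̂)` in the extended reals, with the stated conventions. -/
def Dkl {𝒳 𝒴 : Type*} [Fintype 𝒳] [Fintype 𝒴] (w w' wh : Channel 𝒳 𝒴)
    (p : 𝒳 → ℝ) : EReal :=
  if ∃ x y, 0 < wh.w x y * p x ∧ w'.w x y = 0 ∧ 0 < w.w x y then ⊤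
  else if ∃ x y, 0 < wh.w x y * p x ∧ w.w x y = 0 ∧ 0 < w'.w x y then ⊥
  else ((∑ x : 𝒳, ∑ y : 𝒴, wh.w x y * p x * Real.logb 2 (w.w x y / w'.w x y) : ℝ) : EReal)

/-- `sup { D_{wh}(w‖w'|p̂) }` over channels `wh` and pmfs `p̂` on `𝒳`. -/
def DklSup {𝒳 𝒴 : Type*} [Fintype 𝒳] [Fintype 𝒴] (w w' : Channel 𝒳 𝒴) : EReal :=
  sSup {d : EReal | ∃ (wh : Channel 𝒳 𝒴) (p : 𝒳 → ℝ),
    (∀ x, 0 ≤ p x) ∧ (∑ x, p x = 1) ∧ d = Dkl w w' wh p}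

section Probability

variable (μ : PMF Ω)

theorem pr_eq_measureReal (E : Set Ω) : pr μ E = (@PMF.toMeasure Ω ⊤ μ).real E := by
  let _ : MeasurableSpace Ω := ⊤
  rw [pr, MeasureTheory.measureReal_def,
    PMF.toMeasure_apply_eq_toOuterMeasure_apply _ MeasurableSpace.measurableSet_top]

theorem pr_nonneg (E : Set Ω) : 0 ≤ pr μ E := ENNReal.toReal_nonneg

theorem pr_mono {E F : Set Ω} (h : E ⊆ F) : pr μ E ≤ pr μ F := by
  let _ : MeasurableSpace Ω := ⊤
  simp only [pr_eq_measureReal]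
  exact MeasureTheory.measureReal_mono h

theorem pr_univ : pr μ Set.univ = 1 := by
  let _ : MeasurableSpace Ω := ⊤
  simp [pr_eq_measureReal]

theorem pr_le_one (E : Set Ω) : pr μ E ≤ 1 :=
  pr_univ μ ▸ pr_mono μ (Set.subset_univ E)

theorem pr_compl (E : Set Ω) : pr μ Eᶜ = 1 - pr μ E := by
  let _ : MeasurableSpace Ω := ⊤
  simp only [pr_eq_measureReal]
  exact MeasureTheory.probReal_compl_eq_one_sub MeasurableSpace.measurableSet_top

variable {α β : Type*} [Fintype α]

theorem pr_mem_inter (X : Ω → α) (S : Set α) (E : Set Ω) :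
    pr μ ({ω | X ω ∈ S} ∩ E) = ∑ x with x ∈ S, pr μ ({ω | X ω = x} ∩ E) := by
  let _ : MeasurableSpace Ω := ⊤
  simp only [pr_eq_measureReal]
  rw [← MeasureTheory.measureReal_biUnion_finset _ (fun _ _ => MeasurableSpace.measurableSet_top)]
  · congr 1
    ext ω
    simp
  · intro x _ y _ hxy
    refine Set.disjoint_left.2 ?_
    rintro ω ⟨hx, -⟩ ⟨hy, -⟩
    exact hxy (hx.symm.trans hy)

theorem pr_mem (X : Ω → α) (S : Set α) :
    pr μ {ω | X ω ∈ S} = ∑ x with x ∈ S, pr μ {ω | X ω = x} := by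
  simpa using pr_mem_inter μ X S Set.univ

theorem sum_pr_eq_one (X : Ω → α) : ∑ x, pr μ {ω | X ω = x} = 1 := by
  simpa [pr_univ] using (pr_mem μ X Set.univ).symm

theorem sum_cpr_eq_one (X : Ω → α) {E : Set Ω} (hE : 0 < pr μ E) :
    ∑ x, cpr μ {ω | X ω = x} E = 1 := by
  have h := pr_mem_inter μ X Set.univ E
  simp only [Set.mem_univ, Set.ofPred_true, Set.univ_inter, Finset.filter_true] at h
  simp only [cpr, ← Finset.sum_div, ← h]
  exact div_self hE.ne'

theorem cpr_nonneg (E F : Set Ω) : 0 ≤ cpr μ E F := div_nonneg (pr_nonneg μ _) (pr_nonneg μ _)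

theorem cpr_mul_le (E : Set Ω) {F : Set Ω} (hF : 0 < pr μ F) : cpr μ E F * pr μ F ≤ pr μ E := by
  rw [cpr, div_mul_cancel₀ _ hF.ne']
  exact pr_mono μ Set.inter_subset_left

theorem cpr_event (X : Ω → α) (Y : Ω → β) (P : α → β → Prop) (y : β) :
    cpr μ {ω | P (X ω) (Y ω)} {ω | Y ω = y} =
      ∑ x with P x y, cpr μ {ω | X ω = x} {ω | Y ω = y} := by
  have h : {ω | P (X ω) (Y ω)} ∩ {ω | Y ω = y} =
      {ω | X ω ∈ {x | P x y}} ∩ {ω | Y ω = y} := by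
    ext ω
    simp only [Set.mem_inter_iff, Set.mem_ofPred_eq]
    refine and_congr_left ?_
    rintro rfl
    rfl
  rw [cpr, h, pr_mem_inter, Finset.sum_div]
  rfl

theorem hs_nonneg (X : Ω → β) (x : β) : 0 ≤ hs μ X x :=
  neg_nonneg.2 (Real.logb_nonpos one_lt_two (pr_nonneg μ _) (pr_le_one μ _))

theorem suppCard_pos (U : Ω → α) : 0 < suppCard μ U := by
  rw [suppCard, Finset.card_pos]
  by_contra h
  rw [Finset.not_nonempty_iff_eq_empty, Finset.filter_eq_empty_iff] at h
  have hz : ∑ u, pr μ {ω | U ω = u} ≤ 0 :=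
    Finset.sum_nonpos fun u hu => not_lt.1 (h hu)
  rw [sum_pr_eq_one] at hz
  linarith

/-- The values of `U` of probability below `ε / |𝒰|` have total probability at most `ε`. -/
theorem one_sub_le_pr_heavy (U : Ω → α) {ε : ℝ} (hε : 0 ≤ ε) :
    1 - ε ≤ pr μ {ω | U ω ∈ {u | ε / suppCard μ U ≤ pr μ {ω' | U ω' = u}}} := by
  have hn : (0 : ℝ) < suppCard μ U := by exact_mod_cast suppCard_pos μ U
  set S := {u | ε / suppCard μ U ≤ pr μ {ω' | U ω' = u}}
  have hc : pr μ {ω | U ω ∈ Sᶜ} ≤ ε := by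
    rw [pr_mem]
    calc _ ≤ ∑ u with 0 < pr μ {ω | U ω = u}, ε / suppCard μ U := by
          rw [Finset.sum_filter, Finset.sum_filter]
          refine Finset.sum_le_sum fun u _ => ?_
          have h0 : 0 ≤ ε / suppCard μ U := by positivity
          have h1 := pr_nonneg μ {ω | U ω = u}
          by_cases hu : u ∈ Sᶜ
          · have : pr μ {ω | U ω = u} < ε / suppCard μ U := not_le.1 hu
            split_ifs <;> linarith
          · rw [if_neg hu]
            split_ifs <;> linarith
      _ = ε := by
          rw [Finset.sum_const, nsmul_eq_mul, ← suppCard]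
          field_simp
  have h := pr_compl μ {ω | U ω ∈ S}
  have h' : {ω | U ω ∈ S}ᶜ = {ω | U ω ∈ Sᶜ} := rfl
  rw [h'] at h
  linarith

end Probability

section Entropy

variable {α : Type*} [Fintype α] {p r : α → ℝ} {b : ℝ}

/-- A distribution supported where another one is at least `2 ^ (-b)` has entropy at most `b`. -/
theorem entropy_le_of_support_le (hp : ∀ x, 0 ≤ p x) (hp1 : ∑ x, p x = 1) (hr : ∀ x, 0 ≤ r x)
    (hr1 : ∑ x, r x = 1) (hb : ∀ x, 0 < p x → (2 : ℝ) ^ (-b) ≤ r x) :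
    -∑ x, p x * Real.logb 2 (p x) ≤ b := by
  have hlog : 0 < Real.log 2 := Real.log_pos one_lt_two
  have key : ∀ x, p x * (-b * Real.log 2 - Real.log (p x)) ≤ r x - p x := by
    intro x
    rcases (hp x).eq_or_lt with h | h
    · simpa [← h] using hr x
    · have h2 : (0 : ℝ) < 2 ^ (-b) := by positivity
      have h1 := Real.log_le_sub_one_of_pos (div_pos h2 h)
      rw [Real.log_div h2.ne' h.ne', Real.log_rpow two_pos] at h1
      calc p x * (-b * Real.log 2 - Real.log (p x)) ≤ p x * (2 ^ (-b) / p x - 1) := by gcongr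
        _ = 2 ^ (-b) - p x := by field_simp
        _ ≤ r x - p x := by linarith [hb x h]
  have hsum := Finset.sum_le_sum fun x (_ : x ∈ Finset.univ) => key x
  simp only [mul_sub, Finset.sum_sub_distrib, ← Finset.sum_mul, hp1, hr1] at hsum
  simp only [Real.logb, ← mul_div_assoc, ← Finset.sum_div]
  rw [← neg_div, div_le_iff₀ hlog]
  linarith

theorem le_entropy_of_support {a : ℝ} (hp : ∀ x, 0 ≤ p x) (hp1 : ∑ x, p x = 1)
    (ha : ∀ x, 0 < p x → a ≤ -Real.logb 2 (p x)) :
    a ≤ -∑ x, p x * Real.logb 2 (p x) := by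
  calc a = ∑ x, p x * a := by rw [← Finset.sum_mul, hp1, one_mul]
    _ ≤ ∑ x, p x * -Real.logb 2 (p x) := by
      refine Finset.sum_le_sum fun x _ => ?_
      rcases (hp x).eq_or_lt with h | h
      · simp [← h]
      · exact mul_le_mul_of_nonneg_left (ha x h) h.le
    _ = -∑ x, p x * Real.logb 2 (p x) := by simp

/-- It is unlikely under `p` that `-log₂ p` exceeds an upper bound on `-log₂ r` by `t`. -/
theorem sum_lt_of_forall_lt_neg_logb {t : ℝ} (hr : ∀ x, 0 ≤ r x)
    (hr1 : ∑ x, r x = 1) (hb : ∀ x, 0 < p x → (2 : ℝ) ^ (-b) ≤ r x) (T : Finset α)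
    (hT : ∀ x ∈ T, 0 < p x → b + t < -Real.logb 2 (p x)) :
    ∑ x ∈ T, p x < 2 ^ (-t) := by
  have h2 : (0 : ℝ) < 2 ^ (-t) := by positivity
  have key : ∀ x ∈ T, 0 < p x → p x < 2 ^ (-t) * r x := by
    intro x hx h
    have h1 : p x < 2 ^ (-(b + t)) :=
      (Real.logb_lt_iff_lt_rpow one_lt_two h).1 (by linarith [hT x hx h])
    calc p x < 2 ^ (-(b + t)) := h1
      _ = 2 ^ (-t) * 2 ^ (-b) := by rw [← Real.rpow_add two_pos]; ring_nf
      _ ≤ 2 ^ (-t) * r x := by gcongr; exact hb x h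
  have hle : ∀ x ∈ T, p x ≤ 2 ^ (-t) * r x := fun x hx =>
    (le_or_gt (p x) 0).elim (fun h => h.trans (mul_nonneg h2.le (hr x))) fun h => (key x hx h).le
  have hT1 : ∑ x ∈ T, 2 ^ (-t) * r x ≤ 2 ^ (-t) := by
    rw [← Finset.mul_sum]
    have := Finset.sum_le_univ_sum_of_nonneg (s := T) hr
    nlinarith
  by_cases h : ∃ x ∈ T, 0 < p x
  · obtain ⟨x, hx, hpx⟩ := h
    exact (Finset.sum_lt_sum hle ⟨x, hx, key x hx hpx⟩).trans_le hT1
  · push Not at h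
    exact (Finset.sum_nonpos h).trans_lt h2

end Entropy

section Conditioning

variable {α β : Type*} {μ : PMF Ω} {X : Ω → α} {Y : Ω → β} {y : β}

/-- The integer part of `h_X(x)`, truncated at `ψ`. -/
def spectrumLevel (μ : PMF Ω) (X : Ω → α) (ψ : ℕ) (x : α) : Fin (ψ + 1) :=
  ⟨min ⌊hs μ X x⌋₊ ψ, by omega⟩

theorem spectrumLevel_le_hs (μ : PMF Ω) (X : Ω → α) (ψ : ℕ) (x : α) :
    ((spectrumLevel μ X ψ x : ℕ) : ℝ) ≤ hs μ X x :=
  (Nat.cast_le.2 (min_le_left _ _)).trans (Nat.floor_le (hs_nonneg μ X x))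

theorem spectrumLevel_bounds {ψ q : ℕ} {x : α} (h : (spectrumLevel μ X ψ x : ℕ) = q)
    (hq : q < ψ) : (q : ℝ) ≤ hs μ X x ∧ hs μ X x ≤ q + 1 := by
  have h' : min ⌊hs μ X x⌋₊ ψ = q := h
  have hfloor : ⌊hs μ X x⌋₊ = q := by omega
  exact ⟨h ▸ spectrumLevel_le_hs μ X ψ x, hfloor ▸ (Nat.lt_floor_add_one (hs μ X x)).le⟩

theorem le_hcs_of_le_hs {ρ n a : ℝ} (hn : 0 < n) (hy : 2 ^ (-ρ) / n ≤ pr μ {ω | Y ω = y}) {x : α}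
    (hx : 0 < cpr μ {ω | X ω = x} {ω | Y ω = y}) (ha : a ≤ hs μ X x) :
    a - ρ - Real.logb 2 n ≤ hcs μ X Y x y := by
  have hpos : (0 : ℝ) < 2 ^ (-ρ) / n := by positivity
  have hlog : -ρ - Real.logb 2 n ≤ Real.logb 2 (pr μ {ω | Y ω = y}) := by
    have := Real.logb_le_logb_of_le one_lt_two hpos hy
    rwa [Real.logb_div (by positivity) hn.ne', Real.logb_rpow two_pos (by norm_num)] at this
  have hY := hpos.trans_le hy
  have h := Real.logb_le_logb_of_le one_lt_two (mul_pos hx hY) (cpr_mul_le μ {ω | X ω = x} hY)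
  rw [Real.logb_mul hx.ne' hY.ne'] at h
  simp only [hs, hcs] at ha ⊢
  linarith

theorem two_rpow_neg_le_of_hs_le {b : ℝ} (hy : 0 < pr μ {ω | Y ω = y}) {x : α}
    (hx : 0 < cpr μ {ω | X ω = x} {ω | Y ω = y}) (hb : hs μ X x ≤ b) :
    (2 : ℝ) ^ (-b) ≤ pr μ {ω | X ω = x} := by
  have h : 0 < pr μ {ω | X ω = x} := (mul_pos hx hy).trans_le (cpr_mul_le μ _ hy)
  rw [← Real.le_logb_iff_rpow_le one_lt_two h]
  simp only [hs] at hb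
  linarith

theorem exists_mem_of_cpr_pos {E F G : Set Ω} (hG : pr μ G = 1) (h : 0 < cpr μ E F) :
    ∃ ω ∈ G, ω ∈ E ∧ ω ∈ F := by
  by_contra! hne
  have hsub : E ∩ F ⊆ Gᶜ := fun ω hω hωG => hne ω hωG hω.1 hω.2
  have h0 : pr μ (E ∩ F) = 0 :=
    le_antisymm ((pr_mono μ hsub).trans (by rw [pr_compl, hG, sub_self])) (pr_nonneg μ _)
  simp [cpr, h0] at h

variable [Fintype α]

/-- If `h_X` lies in `[a, b]` on the values of `X` compatible with `Y = y`, then both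
`H(X | Y = y)` and, with high conditional probability, `h(X | Y)` are close to `[a, b]`. -/
theorem cpr_abs_hcs_sub_lt {ρ n a b c δ : ℝ} (hn : 0 < n)
    (hy : 2 ^ (-ρ) / n ≤ pr μ {ω | Y ω = y})
    (hab : ∀ x, 0 < cpr μ {ω | X ω = x} {ω | Y ω = y} → a ≤ hs μ X x ∧ hs μ X x ≤ b)
    (hc : c ≤ a - ρ - Real.logb 2 n + δ) (hc' : b + ρ - δ ≤ c) :
    cpr μ {ω | |hcs μ X Y (X ω) (Y ω) - c| > δ} {ω | Y ω = y} < 2 ^ (-ρ) := by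
  have hY : 0 < pr μ {ω | Y ω = y} := lt_of_lt_of_le (by positivity) hy
  rw [cpr_event μ X Y fun x y => |hcs μ X Y x y - c| > δ]
  refine sum_lt_of_forall_lt_neg_logb (fun x => pr_nonneg μ {ω | X ω = x}) (sum_pr_eq_one μ X)
    (fun x hx => two_rpow_neg_le_of_hs_le hY hx (hab x hx).2) _ fun x hx hpx => ?_
  have hlow := le_hcs_of_le_hs hn hy hpx (hab x hpx).1
  rw [Finset.mem_filter] at hx
  change b + ρ < hcs μ X Y x y
  rcases lt_abs.1 hx.2 with h | h <;> linarith

theorem HEvt_mem_Icc {ρ n a b : ℝ} (hn : 0 < n) (hy : 2 ^ (-ρ) / n ≤ pr μ {ω | Y ω = y})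
    (hab : ∀ x, 0 < cpr μ {ω | X ω = x} {ω | Y ω = y} → a ≤ hs μ X x ∧ hs μ X x ≤ b) :
    HEvt μ X {ω | Y ω = y} ∈ Set.Icc (a - ρ - Real.logb 2 n) b := by
  have hY : 0 < pr μ {ω | Y ω = y} := lt_of_lt_of_le (by positivity) hy
  have hp := fun x => cpr_nonneg μ {ω | X ω = x} {ω | Y ω = y}
  have hp1 := sum_cpr_eq_one μ X hY
  exact ⟨le_entropy_of_support hp hp1 fun x hx => le_hcs_of_le_hs hn hy hx (hab x hx).1,
    entropy_le_of_support_le hp hp1 (fun x => pr_nonneg μ {ω | X ω = x}) (sum_pr_eq_one μ X)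
      fun x hx => two_rpow_neg_le_of_hs_le hY hx (hab x hx).2⟩

theorem cpr_hcs_lt_eq_zero {ρ n a c : ℝ} (hn : 0 < n) (hy : 2 ^ (-ρ) / n ≤ pr μ {ω | Y ω = y})
    (ha : ∀ x, 0 < cpr μ {ω | X ω = x} {ω | Y ω = y} → a ≤ hs μ X x)
    (hc : c ≤ a - ρ - Real.logb 2 n) :
    cpr μ {ω | hcs μ X Y (X ω) (Y ω) < c} {ω | Y ω = y} = 0 := by
  rw [cpr_event μ X Y fun x y => hcs μ X Y x y < c]
  refine Finset.sum_eq_zero fun x hx => ?_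
  rw [Finset.mem_filter] at hx
  by_contra hne
  have hpx := (cpr_nonneg μ {ω | X ω = x} {ω | Y ω = y}).lt_of_ne' hne
  linarith [le_hcs_of_le_hs hn hy hpx (ha x hpx)]

end Conditioning

/-- Theorem `lem:mt_aug:1`. -/
theorem message_stabilizing_variable
    {Ω : Type} (μ : PMF Ω) (l : ℕ) (hl : 0 < l)
    (𝓜 : Fin l → Type) [∀ j, Fintype (𝓜 j)] (M : ∀ j, Ω → 𝓜 j)
    (ψ : ℕ) (hψ : 0 < ψ) (ρ : ℝ) (hρ : 1 ≤ ρ) (β : ℝ)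
    (hβ : β = 14 * ρ + 2 ^ (-ρ) * (ψ : ℝ)) :
    ∃ (𝒬 : Type) (_ : Fintype 𝒬) (f : (∀ j, 𝓜 j) → 𝒬),
      Fintype.card 𝒬 ≤ (ψ + 1) ^ l ∧
      ∀ (𝒰 : Type) [Fintype 𝒰], ∀ (U : Ω → 𝒰),
        (∃ g : 𝒰 → 𝒬, pr μ {ω | f (fun j => M j ω) = g (U ω)} = 1) →
        ∀ j : Fin l,
          (∃ Sstab Ssat : Set 𝒰,
            1 - 2 ^ (-ρ) ≤ pr μ {ω | U ω ∈ Sstab ∪ Ssat} ∧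
            (∀ u ∈ Sstab,
              cpr μ
                {ω | |hcs μ (M j) U (M j ω) (U ω) - HEvt μ (M j) {ω' | U ω' = u}| >
                  β + 3 * Real.logb 2 (suppCard μ U)}
                {ω | U ω = u} < 2 ^ (-ρ)) ∧
            (∀ u ∈ Ssat,
              cpr μ
                {ω | hcs μ (M j) U (M j ω) (U ω) <
                  (ψ : ℝ) - β - 3 * Real.logb 2 (suppCard μ U)}
                {ω | U ω = u} < 2 ^ (-ρ))) ∧
          ((∀ m : 𝓜 j, pr μ {ω | M j ω = m} = 1 / (Fintype.card (𝓜 j) : ℝ)) →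
            ∃ S' : Set 𝒰,
              1 - 2 ^ (-ρ) ≤ pr μ {ω | U ω ∈ S'} ∧
              ∀ u ∈ S',
                cpr μ
                  {ω | |hcs μ (M j) U (M j ω) (U ω) -
                      Real.logb 2 (Fintype.card (𝓜 j))| >
                    β + 3 * Real.logb 2 (suppCard μ U)}
                  {ω | U ω = u} < 2 ^ (-ρ)) := by
  refine ⟨Fin l → Fin (ψ + 1), inferInstance, fun m j => spectrumLevel μ (M j) ψ (m j),
    by simp, ?_⟩
  rintro 𝒰 _ U ⟨g, hg⟩ j
  have hn0 := suppCard_pos μ U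
  have hn : (0 : ℝ) < suppCard μ U := by exact_mod_cast hn0
  have hlog : 0 ≤ Real.logb 2 (suppCard μ U) :=
    Real.logb_nonneg one_lt_two (by exact_mod_cast hn0)
  have hε : (0 : ℝ) < 2 ^ (-ρ) := by positivity
  have hβρ : 14 * ρ ≤ β := by rw [hβ]; exact le_add_of_nonneg_right (by positivity)
  have hheavy := one_sub_le_pr_heavy μ U hε.le
  set S := {u | 2 ^ (-ρ) / (suppCard μ U : ℝ) ≤ pr μ {ω' | U ω' = u}}
  have hlevel : ∀ u m, 0 < cpr μ {ω | M j ω = m} {ω | U ω = u} →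
      spectrumLevel μ (M j) ψ m = g u j := by
    intro u m h
    obtain ⟨ω, hω, rfl, rfl⟩ := exists_mem_of_cpr_pos hg h
    exact congrFun hω j
  refine ⟨⟨{u | u ∈ S ∧ (g u j : ℕ) < ψ}, {u | u ∈ S ∧ (g u j : ℕ) = ψ}, ?_, ?_, ?_⟩, ?_⟩
  · refine hheavy.trans (pr_mono μ fun ω hω => ?_)
    rcases (Nat.lt_succ_iff.1 (g (U ω) j).2).lt_or_eq with h | h
    · exact Or.inl ⟨hω, h⟩
    · exact Or.inr ⟨hω, h⟩
  · rintro u ⟨huS, hlt⟩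
    have hab : ∀ m, 0 < cpr μ {ω | M j ω = m} {ω | U ω = u} →
        ((g u j : ℕ) : ℝ) ≤ hs μ (M j) m ∧ hs μ (M j) m ≤ ((g u j : ℕ) : ℝ) + 1 := by
      intro m hm
      exact spectrumLevel_bounds (congrArg Fin.val (hlevel u m hm)) hlt
    have hH := HEvt_mem_Icc hn huS hab
    exact cpr_abs_hcs_sub_lt hn huS hab (by linarith [hH.2]) (by linarith [hH.1])
  · rintro u ⟨huS, heq⟩
    refine (cpr_hcs_lt_eq_zero (a := ψ) hn huS (fun m hm => ?_) (by linarith)).trans_lt hε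
    have h := congrArg Fin.val (hlevel u m hm)
    rw [heq] at h
    simpa [h] using spectrumLevel_le_hs μ (M j) ψ m
  · intro hunif
    refine ⟨S, hheavy, fun u hu => ?_⟩
    have hs_eq : ∀ m, hs μ (M j) m = Real.logb 2 (Fintype.card (𝓜 j)) := by
      intro m
      rw [hs, hunif, one_div, Real.logb_inv, neg_neg]
    exact cpr_abs_hcs_sub_lt hn hu (fun m _ => ⟨(hs_eq m).ge, (hs_eq m).le⟩)
      (by linarith) (by linarith)

end Paper
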